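/- Poisson analogue for the divisor function with a periodic weight (Theorem 2(III)): Let k ≥ 1 be an integer, χ : ℤ → ℂ with χ(n + k) = χ(n) for all n, let a, b be real numbers with 0 ≤ a < b and a, b ∉ ℤ, and let f : ℝ → ℂ be continuously differentiable on [a,b]. Then the symmetric series below converges and Σ_{a < n ≤ b} χ(n) d(n) f(n) = Σ_{r₁=1}^{k} Σ_{r₂=1}^{k} χ(r₁ r₂) Σ′_n e^{−2πinr₂/k} ∫_a^b f(u) ( Σ_{1 ≤ m ≤ b, m ≡ r₁ (mod k)} (1/(k·m)) e^{2πinu/(mk)} ) du + (1/k) Σ_{r₁=1}^{k} Σ_{r₂=1}^{k} χ(r₁ r₂) ( ∫_a^b f(u) du ) ( Σ_{1 ≤ m ≤ b, m ≡ r₁ (mod k)} 1/m ). -/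

import Mathlib

open MeasureTheory intervalIntegral Filter

/-- `e(z) = exp(2πiz)`. -/
noncomputable def ee (z : ℂ) : ℂ := Complex.exp (2 * (Real.pi : ℂ) * Complex.I * z)

/-- The symmetric limit `lim_{N→∞} ∑_{1 ≤ |n| ≤ N} g n = L` over nonzero integers. -/
def SymTendsto (g : ℤ → ℂ) (L : ℂ) : Prop :=
  Tendsto (fun N : ℕ => ∑ n ∈ (Finset.Icc (-(N : ℤ)) (N : ℤ)).erase 0, g n) atTop (nhds L)

lemma continuous_ee : Continuous ee := by
  unfold ee; fun_prop

lemma ee_add (z w : ℂ) : ee (z + w) = ee z * ee w := by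
  rw [ee, ee, ee, ← Complex.exp_add]; congr 1; ring

lemma ee_intCast (n : ℤ) : ee n = 1 := by
  rw [ee, Complex.exp_eq_one_iff]; exact ⟨n, by ring⟩

lemma four_mul_abs_le_norm_ee_sub_one (c : ℤ) {t : ℝ} (ht : |t - c| ≤ 1 / 2) :
    4 * |t - c| ≤ ‖ee t - 1‖ := by
  have h1 : ee t = Complex.exp (Complex.I * ((2 * Real.pi * (t - c) : ℝ) : ℂ)) := by
    have : (t : ℂ) = ((t - c : ℝ) : ℂ) + c := by push_cast; ring
    rw [this, ee_add, ee_intCast, mul_one, ee]; congr 1; push_cast; ring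
  have hpi := Real.pi_pos
  rw [h1, Complex.norm_exp_I_mul_ofReal_sub_one, norm_mul, Real.norm_eq_abs, Real.norm_eq_abs,
    show 2 * Real.pi * (t - c) / 2 = Real.pi * (t - c) by ring]
  have h2 : |Real.pi * (t - c)| ≤ Real.pi / 2 := by
    rw [abs_mul, abs_of_pos hpi]; nlinarith
  have h3 := Real.mul_abs_le_abs_sin h2
  rw [abs_mul, abs_of_pos hpi, ← mul_assoc, div_mul_cancel₀ _ hpi.ne'] at h3
  rw [abs_of_pos (two_pos : (0 : ℝ) < 2)]
  linarith

lemma integral_ee_period (n : ℤ) (x : ℝ) :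
    ∫ t in x..(x + 1), ee (n * t) = if n = 0 then 1 else 0 := by
  split_ifs with hn
  · simp [hn, ee]
  · have hc : (2 * Real.pi * Complex.I * n : ℂ) ≠ 0 := by
      have := Complex.two_pi_I_ne_zero
      have hn' : (n : ℂ) ≠ 0 := by exact_mod_cast hn
      exact mul_ne_zero this hn'
    have h : ∀ t : ℝ, ee (n * t) = Complex.exp ((2 * Real.pi * Complex.I * n) * t) := fun t => by
      rw [ee]; congr 1; ring
    simp_rw [h]
    rw [integral_exp_mul_complex hc, ← h, ← h, Complex.ofReal_add, mul_add, ee_add]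
    simp [ee_intCast]

lemma tendsto_natCast_cocompact_real : Tendsto (fun N : ℕ => (N : ℝ)) atTop (cocompact ℝ) :=
  tendsto_natCast_atTop_atTop.mono_right atTop_le_cocompact

lemma tendsto_integral_mul_ee_cocompact (h : ℝ → ℂ) {x y : ℝ} (hxy : x ≤ y) :
    Tendsto (fun w : ℝ => ∫ t in x..y, h t * ee (w * t)) (cocompact ℝ) (nhds 0) := by
  have h1 := (Real.tendsto_integral_exp_smul_cocompact ((Set.Ioc x y).indicator h)).comp
    (Homeomorph.neg ℝ).isClosedEmbedding.tendsto_cocompact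
  refine h1.congr fun w => ?_
  rw [intervalIntegral.integral_of_le hxy, ← MeasureTheory.integral_indicator measurableSet_Ioc]
  refine integral_congr_ae (Eventually.of_forall fun t => ?_)
  by_cases ht : t ∈ Set.Ioc x y
  · simp only [Set.indicator_of_mem ht, Circle.smul_def, Real.fourierChar_apply, smul_eq_mul, ee,
      Homeomorph.coe_neg]
    rw [mul_comm]; congr 2; push_cast; ring
  · simp [Set.indicator_of_notMem ht]

lemma sum_Icc_neg_succ_sub (H : ℤ → ℂ) (N : ℕ) :
    ∑ n ∈ Finset.Icc (-(N : ℤ)) N, (H (n + 1) - H n) = H (N + 1) - H (-N) := by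
  induction N with
  | zero => simp
  | succ N ih =>
    have h : Finset.Icc (-((N + 1 : ℕ) : ℤ)) ((N + 1 : ℕ) : ℤ)
        = insert (-((N : ℤ) + 1)) (insert ((N : ℤ) + 1) (Finset.Icc (-(N : ℤ)) N)) := by
      ext j; simp only [Finset.mem_Icc, Finset.mem_insert]; omega
    rw [h, Finset.sum_insert, Finset.sum_insert, ih]
    · push_cast
      rw [show -((N : ℤ) + 1) + 1 = -N by ring]; ring
    · simp
    · simp only [Finset.mem_Icc, Finset.mem_insert]; omega

/-- Symmetric Fourier partial sums at `0` of the periodization of `G` restricted to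
`[c - 1/2, c + 1/2]` converge to `G c` when `G` is Lipschitz at `c`. -/
lemma tendsto_sum_integral_mul_ee_of_lipschitzAt (c : ℤ) {G : ℝ → ℂ}
    (hG : AEStronglyMeasurable G volume) {C : ℝ} (hC : ∀ t, ‖G t - G c‖ ≤ C * |t - c|) :
    Tendsto (fun N : ℕ => ∑ n ∈ Finset.Icc (-(N : ℤ)) N,
      ∫ t in ((c : ℝ) - 1 / 2)..(c - 1 / 2 + 1), G t * ee (n * t)) atTop (nhds (G c)) := by
  set x : ℝ := (c : ℝ) - 1 / 2 with hx
  set h : ℝ → ℂ := fun t => (G t - G c) / (ee t - 1) with hh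
  have hC0 : 0 ≤ C := by
    have := (norm_nonneg _).trans (hC (c + 1)); simpa using this
  have hmem : ∀ t ∈ Set.Icc x (x + 1), |t - c| ≤ 1 / 2 := fun t ht => by
    rw [abs_le]; constructor <;> linarith [ht.1, ht.2]
  have hid : ∀ t ∈ Set.Icc x (x + 1), h t * (ee t - 1) = G t - G c := fun t ht => by
    by_cases h0 : ee t - 1 = 0
    · have h1 := four_mul_abs_le_norm_ee_sub_one c (hmem t ht)
      rw [h0, norm_zero] at h1
      have h2 : |t - c| = 0 := le_antisymm (by linarith) (abs_nonneg _)
      have h3 : t = c := by linarith [abs_eq_zero.mp h2]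
      simp [h3, ee_intCast]
    · exact div_mul_cancel₀ _ h0
  have hbd : ∀ t ∈ Set.Icc x (x + 1), ‖h t‖ ≤ C := fun t ht => by
    rw [hh, norm_div]
    refine div_le_of_le_mul₀ (norm_nonneg _) hC0 ((hC t).trans ?_)
    have := four_mul_abs_le_norm_ee_sub_one c (hmem t ht)
    exact mul_le_mul_of_nonneg_left (by linarith [abs_nonneg (t - c)]) hC0
  have hee : Measurable fun t : ℝ => ee t - 1 :=
    ((continuous_ee.comp Complex.continuous_ofReal).sub continuous_const).measurable
  have hmeas : AEStronglyMeasurable h volume :=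
    ((hG.sub aestronglyMeasurable_const).aemeasurable.div hee.aemeasurable).aestronglyMeasurable
  have hx1 : x ≤ x + 1 := by linarith
  have hInt : IntervalIntegrable h volume x (x + 1) := by
    rw [intervalIntegrable_iff_integrableOn_Ioc_of_le hx1]
    refine IntegrableOn.of_bound (by simp) hmeas.restrict C ?_
    exact (ae_restrict_mem measurableSet_Ioc).mono fun t ht => hbd t (Set.Ioc_subset_Icc_self ht)
  have hcont : ∀ n : ℤ, Continuous fun t : ℝ => ee (n * t) := fun n =>
    continuous_ee.comp (continuous_const.mul Complex.continuous_ofReal)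
  have hstep : ∀ n : ℤ, ∫ t in x..(x + 1), G t * ee (n * t)
      = (if n = 0 then G c else 0) + ((∫ t in x..(x + 1), h t * ee (((n + 1 : ℤ) : ℝ) * t))
        - ∫ t in x..(x + 1), h t * ee ((n : ℝ) * t)) := fun n => by
    have e1 : ∫ t in x..(x + 1), G t * ee (n * t) = ∫ t in x..(x + 1),
        (G c * ee (n * t) + (h t * ee ((n + 1 : ℤ) * t) - h t * ee (n * t))) := by
      refine intervalIntegral.integral_congr fun t ht => ?_
      rw [Set.uIcc_of_le hx1] at ht
      have : ee ((n + 1 : ℤ) * t) = ee (n * t) * ee t := by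
        rw [← ee_add]; congr 1; push_cast; ring
      simp only [this]
      linear_combination (-ee (n * t)) * hid t ht
    have i1 := hInt.mul_continuousOn (hcont n).continuousOn
    have i2 := hInt.mul_continuousOn (hcont (n + 1)).continuousOn
    have i0 : Continuous fun t : ℝ => G c * ee (n * t) := continuous_const.mul (hcont n)
    rw [e1, intervalIntegral.integral_add (i0.intervalIntegrable _ _)
      (i2.sub i1), intervalIntegral.integral_sub i2 i1, intervalIntegral.integral_const_mul,
      integral_ee_period]
    simp
  have hsum : ∀ N : ℕ, ∑ n ∈ Finset.Icc (-(N : ℤ)) N, ∫ t in x..(x + 1), G t * ee (n * t)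
      = G c + ((∫ t in x..(x + 1), h t * ee (((N + 1 : ℕ) : ℝ) * t))
        - ∫ t in x..(x + 1), h t * ee ((-(N : ℝ) : ℝ) * t)) := fun N => by
    simp_rw [hstep]
    rw [Finset.sum_add_distrib,
      sum_Icc_neg_succ_sub (fun n : ℤ => ∫ t in x..(x + 1), h t * ee ((n : ℝ) * t))]
    simp
  simp_rw [hsum]
  have hRL := tendsto_integral_mul_ee_cocompact h hx1
  have t1 := hRL.comp (tendsto_natCast_cocompact_real.comp (tendsto_add_atTop_nat 1))
  have t2 := hRL.comp ((Homeomorph.neg ℝ).isClosedEmbedding.tendsto_cocompact.comp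
    tendsto_natCast_cocompact_real)
  simpa [Function.comp_def] using (t1.sub t2).const_add (G c)

lemma exists_lipschitzAt_of_bounded {G : ℝ → ℂ} {c M : ℝ} (hM : ∀ t, ‖G t‖ ≤ M)
    (hd : DifferentiableAt ℝ G c) : ∃ C, ∀ t, ‖G t - G c‖ ≤ C * |t - c| := by
  obtain ⟨K, hK⟩ := hd.hasDerivAt.isBigO_sub.bound
  obtain ⟨ε, hε, hb⟩ := Metric.eventually_nhds_iff.mp hK
  have hM0 : 0 ≤ M := (norm_nonneg _).trans (hM 0)
  refine ⟨max K (2 * M / ε), fun t => ?_⟩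
  rcases lt_or_ge |t - c| ε with h | h
  · exact (hb (by rwa [Real.dist_eq])).trans
      (mul_le_mul_of_nonneg_right (le_max_left _ _) (abs_nonneg _))
  · calc ‖G t - G c‖ ≤ 2 * M := by linarith [norm_sub_le (G t) (G c), hM t, hM c]
      _ = 2 * M / ε * ε := by field_simp
      _ ≤ max K (2 * M / ε) * |t - c| := by gcongr; exact le_max_right _ _

/-- Poisson summation on a finite interval with non-integral endpoints. -/
lemma tendsto_sum_integral_mul_ee {α β : ℝ} (hαβ : α < β) (hα : ∀ n : ℤ, α ≠ n)
    (hβ : ∀ n : ℤ, β ≠ n) {g : ℝ → ℂ} (hg : ContinuousOn g (Set.Icc α β))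
    (hd : ∀ t ∈ Set.Ioo α β, DifferentiableAt ℝ g t) :
    Tendsto (fun N : ℕ => ∑ n ∈ Finset.Icc (-(N : ℤ)) N, ∫ t in α..β, g t * ee (n * t)) atTop
      (nhds (∑ j ∈ Finset.Ioc ⌊α⌋ ⌊β⌋, g j)) := by
  set G : ℝ → ℂ := (Set.Ioo α β).indicator g with hG
  have hGm : AEStronglyMeasurable G volume := by
    rw [hG, aestronglyMeasurable_indicator_iff measurableSet_Ioo]
    exact (hg.mono Set.Ioo_subset_Icc_self).aestronglyMeasurable measurableSet_Ioo
  obtain ⟨M, hM⟩ := isCompact_Icc.exists_bound_of_continuousOn hg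
  have hM0 : 0 ≤ M := (norm_nonneg _).trans (hM α ⟨le_rfl, hαβ.le⟩)
  have hGM : ∀ t, ‖G t‖ ≤ M := fun t => by
    by_cases ht : t ∈ Set.Ioo α β
    · rw [hG, Set.indicator_of_mem ht]; exact hM t (Set.Ioo_subset_Icc_self ht)
    · rw [hG, Set.indicator_of_notMem ht, norm_zero]; exact hM0
  have hGd : ∀ c : ℤ, DifferentiableAt ℝ G c := fun c => by
    by_cases hc : (c : ℝ) ∈ Set.Ioo α β
    · refine (hd c hc).congr_of_eventuallyEq ?_
      filter_upwards [isOpen_Ioo.mem_nhds hc] with t ht using Set.indicator_of_mem ht g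
    · have hc' : (c : ℝ) ∈ (Set.Icc α β)ᶜ := fun h =>
        hc ⟨lt_of_le_of_ne h.1 (hα c), lt_of_le_of_ne h.2 (hβ c).symm⟩
      refine (differentiableAt_const (0 : ℂ)).congr_of_eventuallyEq ?_
      filter_upwards [isClosed_Icc.isOpen_compl.mem_nhds hc'] with t ht
      exact Set.indicator_of_notMem (fun h => ht (Set.Ioo_subset_Icc_self h)) g
  set K : ℕ := (⌊β⌋ - ⌊α⌋ + 2).toNat with hK
  have hfl : ⌊α⌋ ≤ ⌊β⌋ := Int.floor_le_floor hαβ.le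
  have hKZ : (K : ℤ) = ⌊β⌋ - ⌊α⌋ + 2 := Int.toNat_of_nonneg (by omega)
  have hKR : (K : ℝ) = ⌊β⌋ - ⌊α⌋ + 2 := by exact_mod_cast hKZ
  set p : ℕ → ℝ := fun i => ((⌊α⌋ + i : ℤ) : ℝ) - 1 / 2 with hp
  have hp1 : ∀ i, p (i + 1) = p i + 1 := fun i => by simp only [hp]; push_cast; ring
  have hp0 : p 0 ≤ α := by
    simp only [hp]; push_cast; linarith [Int.floor_le α]
  have hpK : β ≤ p K := by
    simp only [hp]; push_cast; linarith [Int.lt_floor_add_one β]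
  have hcont : ∀ n : ℤ, Continuous fun t : ℝ => ee (n * t) := fun n =>
    continuous_ee.comp (continuous_const.mul Complex.continuous_ofReal)
  have hInt : ∀ (n : ℤ) (x y : ℝ), IntervalIntegrable (fun t => G t * ee (n * t)) volume x y :=
    fun n x y => by
      refine IntervalIntegrable.mul_continuousOn ?_ (hcont n).continuousOn
      rw [intervalIntegrable_iff]
      exact IntegrableOn.of_bound (by simp [Set.uIoc]) hGm.restrict M
        (Eventually.of_forall hGM)
  have hsplit : ∀ n : ℤ, ∫ t in α..β, g t * ee (n * t)
      = ∑ i ∈ Finset.range K, ∫ t in p i..(p i + 1), G t * ee (n * t) := fun n => by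
    simp_rw [← hp1]
    rw [intervalIntegral.sum_integral_adjacent_intervals fun i _ => hInt n _ _,
      intervalIntegral.integral_of_le hαβ.le,
      intervalIntegral.integral_of_le (hp0.trans (hαβ.le.trans hpK)),
      integral_Ioc_eq_integral_Ioo]
    have : (fun t => G t * ee (n * t)) = (Set.Ioo α β).indicator fun t => g t * ee (n * t) := by
      ext t; rw [hG, Set.indicator_mul_left]
    rw [this, setIntegral_indicator measurableSet_Ioo, Set.inter_eq_self_of_subset_right]
    exact fun t ht => ⟨hp0.trans_lt ht.1, ht.2.le.trans hpK⟩
  have hlim : ∑ j ∈ Finset.Ioc ⌊α⌋ ⌊β⌋, g j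
      = ∑ i ∈ Finset.range K, G ((⌊α⌋ + i : ℤ) : ℝ) := by
    refine Finset.sum_of_injOn (fun j => (j - ⌊α⌋).toNat) ?_ ?_ ?_ ?_
    · intro i hi j hj hij
      simp only [Finset.coe_Ioc, Set.mem_Ioc] at hi hj hij
      omega
    · intro i hi
      simp only [Finset.coe_Ioc, Set.mem_Ioc, Finset.coe_range, Set.mem_Iio] at hi ⊢
      omega
    · intro i _ hi
      refine Set.indicator_of_notMem (fun h => hi ⟨⌊α⌋ + i, ?_, by simp⟩) g
      rw [Finset.coe_Ioc, Set.mem_Ioc]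
      exact ⟨Int.floor_lt.mpr h.1, Int.le_floor.mpr h.2.le⟩
    · intro j hj
      rw [Finset.mem_Ioc] at hj
      have h1 : ⌊α⌋ + ((j - ⌊α⌋).toNat : ℤ) = j := by omega
      rw [h1, hG, Set.indicator_of_mem]
      exact ⟨Int.floor_lt.mp hj.1, lt_of_le_of_ne (Int.le_floor.mp hj.2) (hβ j).symm⟩
  rw [hlim]
  simp_rw [hsplit]
  simp_rw [Finset.sum_comm (s := Finset.Icc _ _)]
  refine tendsto_finsetSum _ fun i _ => ?_
  obtain ⟨C, hC⟩ := exists_lipschitzAt_of_bounded hGM (hGd (⌊α⌋ + i))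
  exact tendsto_sum_integral_mul_ee_of_lipschitzAt (⌊α⌋ + i) hGm hC

/-- Poisson summation for `f (m * l)` over `l` in a residue class modulo `k`. -/
lemma tendsto_sum_integral_mul_ee_progression {k m : ℤ} (hk : 1 ≤ k) (hm : 1 ≤ m) (r : ℤ)
    {a b : ℝ} (ha0 : 0 ≤ a) (hab : a < b) (ha : ∀ n : ℤ, a ≠ n) (hb : ∀ n : ℤ, b ≠ n)
    {f : ℝ → ℂ} (hf : ContDiffOn ℝ 1 f (Set.Icc a b)) :
    Tendsto (fun N : ℕ => ∑ n ∈ Finset.Icc (-(N : ℤ)) N, ee (-(n : ℂ) * r / k) *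
        ∫ u in a..b, f u * (1 / ((k : ℂ) * m) * ee ((n : ℂ) * u / ((m : ℂ) * k)))) atTop
      (nhds (∑ l ∈ (Finset.Icc 1 ⌊b⌋).filter (fun l => l % k = r % k),
        if m * l ∈ Finset.Ioc ⌊a⌋ ⌊b⌋ then f ((m * l : ℤ) : ℝ) else 0)) := by
  have hkR : (0 : ℝ) < k := by exact_mod_cast hk
  have hmR : (0 : ℝ) < m := by exact_mod_cast hm
  have hkC : (k : ℂ) ≠ 0 := by exact_mod_cast hkR.ne'
  have hmC : (m : ℂ) ≠ 0 := by exact_mod_cast hmR.ne'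
  set c : ℝ := m * k with hc
  set d : ℝ := m * r with hd
  have hc0 : 0 < c := mul_pos hmR hkR
  have hval : ∀ x : ℝ, c * ((x - d) / c) + d = x := fun x => by field_simp; ring
  have hcast : ∀ j : ℤ, c * j + d = ((m * (r + k * j) : ℤ) : ℝ) := fun j => by
    rw [hc, hd]; push_cast; ring
  have hnot : ∀ x : ℝ, (∀ n : ℤ, x ≠ n) → ∀ n : ℤ, (x - d) / c ≠ n := fun x hx n h =>
    hx (m * (r + k * n)) (by rw [← hcast, ← h, hval])
  have hIcc : ∀ t ∈ Set.Icc ((a - d) / c) ((b - d) / c), c * t + d ∈ Set.Icc a b := fun t ht => by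
    have h1 := ht.1; have h2 := ht.2
    rw [div_le_iff₀ hc0] at h1; rw [le_div_iff₀ hc0] at h2
    constructor <;> linarith
  have hIoo : ∀ t ∈ Set.Ioo ((a - d) / c) ((b - d) / c), c * t + d ∈ Set.Ioo a b := fun t ht => by
    have h1 := ht.1; have h2 := ht.2
    rw [div_lt_iff₀ hc0] at h1; rw [lt_div_iff₀ hc0] at h2
    constructor <;> linarith
  have key := tendsto_sum_integral_mul_ee (g := fun t => f (c * t + d))
    (show (a - d) / c < (b - d) / c by gcongr) (hnot a ha) (hnot b hb)
    (hf.continuousOn.comp (by fun_prop) hIcc) (fun t ht => by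
      have h1 : DifferentiableAt ℝ f (c * t + d) :=
        ((hf.differentiableOn one_ne_zero).differentiableAt
          (Icc_mem_nhds (hIoo t ht).1 (hIoo t ht).2))
      exact h1.comp t (by fun_prop))
  have hlim : ∑ j ∈ Finset.Ioc ⌊(a - d) / c⌋ ⌊(b - d) / c⌋, f (c * j + d)
      = ∑ l ∈ (Finset.Icc 1 ⌊b⌋).filter (fun l => l % k = r % k),
        if m * l ∈ Finset.Ioc ⌊a⌋ ⌊b⌋ then f ((m * l : ℤ) : ℝ) else 0 := by
    have hiff : ∀ j : ℤ, j ∈ Finset.Ioc ⌊(a - d) / c⌋ ⌊(b - d) / c⌋ ↔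
        m * (r + k * j) ∈ Finset.Ioc ⌊a⌋ ⌊b⌋ := fun j => by
      rw [Finset.mem_Ioc, Finset.mem_Ioc, Int.floor_lt, Int.floor_lt, Int.le_floor, Int.le_floor,
        ← hcast, div_lt_iff₀ hc0, le_div_iff₀ hc0, sub_lt_iff_lt_add, le_sub_iff_add_le,
        mul_comm c]
    have hfa : 0 ≤ ⌊a⌋ := Int.floor_nonneg.mpr ha0
    have hpos : ∀ l : ℤ, m * l ∈ Finset.Ioc ⌊a⌋ ⌊b⌋ → l ∈ Finset.Icc 1 ⌊b⌋ := fun l hl => by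
      rw [Finset.mem_Ioc] at hl
      have h1 : 0 < l := by
        by_contra h
        nlinarith
      exact Finset.mem_Icc.mpr ⟨h1, by nlinarith⟩
    rw [← Finset.sum_filter, Finset.filter_filter]
    refine Finset.sum_nbij' (fun j => r + k * j) (fun l => (l - r) / k) ?_ ?_ ?_ ?_ ?_
    · intro j hj
      have h := (hiff j).mp hj
      exact Finset.mem_filter.mpr ⟨hpos _ h, by simp, h⟩
    · intro l hl
      rw [Finset.mem_filter] at hl
      have h : k * ((l - r) / k) = l - r :=
        Int.mul_ediv_cancel' (Int.ModEq.dvd (show r ≡ l [ZMOD k] from hl.2.1.symm))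
      rw [hiff, h, add_sub_cancel]
      exact hl.2.2
    · intro j _
      simp [Int.mul_ediv_cancel_left j (show k ≠ 0 by omega)]
    · intro l hl
      rw [Finset.mem_filter] at hl
      have h : k * ((l - r) / k) = l - r :=
        Int.mul_ediv_cancel' (Int.ModEq.dvd (show r ≡ l [ZMOD k] from hl.2.1.symm))
      simp only [h, add_sub_cancel]
    · intro j _
      simp only [hcast]
  simp only [hlim] at key
  refine key.congr fun N => Finset.sum_congr rfl fun n _ => ?_
  have h1 := intervalIntegral.integral_comp_mul_add (a := (a - d) / c) (b := (b - d) / c)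
    (fun u => f u * ee (n * ((u - d) / c : ℝ))) hc0.ne' d
  have h2 : ∀ t : ℝ, (c * t + d - d) / c = t := fun t => by field_simp; ring
  simp only [h2, hval] at h1
  rw [h1, ← intervalIntegral.integral_const_mul, ← intervalIntegral.integral_smul]
  refine intervalIntegral.integral_congr fun u _ => ?_
  have h3 : ee (n * ((u - d) / c : ℝ)) = ee (-(n : ℂ) * r / k) * ee (n * u / (m * k)) := by
    rw [← ee_add, hc, hd]; congr 1; push_cast; field_simp; ring
  simp only [h3, Complex.real_smul]
  rw [hc]
  push_cast
  field_simp

lemma card_filter_mul_eq {n B : ℤ} (hn : 0 < n) (hB : n ≤ B) :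
    ((Finset.Icc 1 B ×ˢ Finset.Icc 1 B).filter fun p => p.1 * p.2 = n).card
      = n.toNat.divisors.card := by
  have hN : (n.toNat : ℤ) = n := Int.toNat_of_nonneg hn.le
  refine Finset.card_nbij' (fun p => p.1.toNat) (fun d => ((d : ℤ), n / d)) ?_ ?_ ?_ ?_
  · rintro ⟨x, y⟩ h
    simp only [Finset.coe_filter, Finset.mem_product, Finset.mem_Icc, Set.mem_ofPred_eq] at h
    simp only [Finset.mem_coe, Nat.mem_divisors]
    refine ⟨?_, by omega⟩
    zify
    rw [hN, Int.toNat_of_nonneg (by omega)]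
    exact ⟨y, h.2.symm⟩
  · intro d h
    simp only [Finset.mem_coe, Nat.mem_divisors] at h
    have hd : (d : ℤ) ∣ n := by rw [← hN]; exact_mod_cast h.1
    have hd0 : (0 : ℤ) < d := by exact_mod_cast Nat.pos_of_dvd_of_pos h.1 (by omega)
    obtain ⟨e, he⟩ := hd
    have he' : n / d = e := by rw [he, Int.mul_ediv_cancel_left _ hd0.ne']
    have he0 : 0 < e := by
      by_contra hc
      nlinarith
    simp only [Finset.coe_filter, Finset.mem_product, Finset.mem_Icc, Set.mem_ofPred_eq, he']
    exact ⟨⟨⟨hd0, by nlinarith⟩, he0, by nlinarith⟩, he.symm⟩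
  · rintro ⟨x, y⟩ h
    simp only [Finset.coe_filter, Finset.mem_product, Finset.mem_Icc, Set.mem_ofPred_eq] at h
    have hx : (x.toNat : ℤ) = x := Int.toNat_of_nonneg (by omega)
    simp only [hx, ← h.2, Int.mul_ediv_cancel_left y (show x ≠ 0 by omega)]
  · intro d _
    simp

lemma sum_card_divisors_mul {A B : ℤ} (hA : 0 ≤ A) (F : ℤ → ℂ) :
    ∑ n ∈ Finset.Ioc A B, (n.toNat.divisors.card : ℂ) * F n
      = ∑ m ∈ Finset.Icc 1 B, ∑ l ∈ Finset.Icc 1 B,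
        if m * l ∈ Finset.Ioc A B then F (m * l) else 0 := by
  rw [← Finset.sum_product', ← Finset.sum_filter,
    ← Finset.sum_fiberwise_of_maps_to (g := fun p : ℤ × ℤ => p.1 * p.2) (t := Finset.Ioc A B)
      fun p hp => (Finset.mem_filter.mp hp).2]
  refine Finset.sum_congr rfl fun n hn => ?_
  have hn' := Finset.mem_Ioc.mp hn
  rw [← card_filter_mul_eq (by omega) hn'.2, Finset.filter_filter, ← nsmul_eq_mul,
    ← Finset.sum_const]
  refine Finset.sum_congr (Finset.filter_congr fun p _ => ?_) fun p hp => ?_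
  · exact ⟨fun h => ⟨h ▸ hn, h⟩, fun h => h.2⟩
  · rw [(Finset.mem_filter.mp hp).2.2]

lemma sum_sum_filter_emod {k : ℤ} (hk : 1 ≤ k) (s : Finset ℤ) (F : ℤ → ℂ) :
    ∑ r ∈ Finset.Icc 1 k, ∑ m ∈ s.filter (fun m => m % k = r % k), F m = ∑ m ∈ s, F m := by
  have hmem : ∀ m : ℤ, (m - 1) % k + 1 ∈ Finset.Icc 1 k := fun m => by
    have h1 := Int.emod_nonneg (m - 1) (show k ≠ 0 by omega)
    have h2 := Int.emod_lt_of_pos (m - 1) (show 0 < k by omega)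
    rw [Finset.mem_Icc]; omega
  refine Eq.trans ?_
    (Finset.sum_fiberwise_of_maps_to (g := fun m => (m - 1) % k + 1) (fun m _ => hmem m) F)
  refine Finset.sum_congr rfl fun r hr => Finset.sum_congr (Finset.filter_congr fun m _ => ?_)
    fun _ _ => rfl
  rw [Finset.mem_Icc] at hr
  have h1 : (r - 1) % k = r - 1 := Int.emod_eq_of_lt (by omega) (by omega)
  constructor
  · intro h
    have := Int.ModEq.sub_right 1 (show m ≡ r [ZMOD k] from h)
    rw [Int.ModEq, h1] at this
    omega
  · intro h
    have : m - 1 ≡ r - 1 [ZMOD k] := by rw [Int.ModEq, h1]; omega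
    simpa [Int.ModEq] using this.add_right 1

/-- Poisson analogue for the divisor function with a periodic weight (Theorem 2(III)). -/
theorem poisson_divisor_periodic_weight
    (k : ℕ) (hk : 1 ≤ k) (χ : ℤ → ℂ) (hχ : ∀ n : ℤ, χ (n + (k : ℤ)) = χ n)
    (a b : ℝ) (ha0 : 0 ≤ a) (hab : a < b)
    (ha : ∀ n : ℤ, a ≠ (n : ℝ)) (hb : ∀ n : ℤ, b ≠ (n : ℝ))
    (f : ℝ → ℂ) (hf : ContDiffOn ℝ 1 f (Set.Icc a b)) :
    ∃ L : ℤ → ℤ → ℂ,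
      (∀ r₁ ∈ Finset.Icc (1 : ℤ) (k : ℤ), ∀ r₂ ∈ Finset.Icc (1 : ℤ) (k : ℤ),
        SymTendsto
          (fun n => ee (-(n : ℂ) * (r₂ : ℂ) / (k : ℂ)) *
            ∫ u in a..b, f u *
              ∑ m ∈ (Finset.Icc (1 : ℤ) ⌊b⌋).filter (fun m => m % (k : ℤ) = r₁ % (k : ℤ)),
                (1 / ((k : ℂ) * (m : ℂ))) * ee ((n : ℂ) * (u : ℂ) / ((m : ℂ) * (k : ℂ))))
          (L r₁ r₂)) ∧
      ∑ n ∈ Finset.Ioc ⌊a⌋ ⌊b⌋, χ n * (n.toNat.divisors.card : ℂ) * f (n : ℝ)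
        = (∑ r₁ ∈ Finset.Icc (1 : ℤ) (k : ℤ), ∑ r₂ ∈ Finset.Icc (1 : ℤ) (k : ℤ),
            χ (r₁ * r₂) * L r₁ r₂)
          + (1 / (k : ℂ)) * ∑ r₁ ∈ Finset.Icc (1 : ℤ) (k : ℤ),
              ∑ r₂ ∈ Finset.Icc (1 : ℤ) (k : ℤ), χ (r₁ * r₂) *
                ((∫ u in a..b, f u) *
                  ∑ m ∈ (Finset.Icc (1 : ℤ) ⌊b⌋).filter
                      (fun m => m % (k : ℤ) = r₁ % (k : ℤ)), 1 / (m : ℂ)) := by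
  have hkZ : (1 : ℤ) ≤ k := by exact_mod_cast hk
  have hper : ∀ x y : ℤ, x ≡ y [ZMOD (k : ℤ)] → χ x = χ y := fun x y h => by
    obtain ⟨j, hj⟩ := h.dvd
    have hp : Function.Periodic χ (k : ℤ) := hχ
    rw [show y = x + j * k by linarith]
    exact (hp.int_mul j x).symm
  set S : ℤ → Finset ℤ := fun r => (Finset.Icc (1 : ℤ) ⌊b⌋).filter
    (fun m => m % (k : ℤ) = r % (k : ℤ)) with hS
  set T : ℤ → ℤ → ℂ := fun r₁ r₂ => ∑ m ∈ S r₁, ∑ l ∈ S r₂,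
    if m * l ∈ Finset.Ioc ⌊a⌋ ⌊b⌋ then f ((m * l : ℤ) : ℝ) else 0 with hT
  set Z : ℤ → ℂ := fun r₁ => (∫ u in a..b, f u) * ∑ m ∈ S r₁, 1 / (m : ℂ) with hZ
  refine ⟨fun r₁ r₂ => T r₁ r₂ - 1 / (k : ℂ) * Z r₁, fun r₁ _ r₂ _ => ?_, ?_⟩
  · have hlim := tendsto_finsetSum (S r₁) fun m hm =>
      tendsto_sum_integral_mul_ee_progression hkZ
        (Finset.mem_Icc.mp (Finset.mem_filter.mp hm).1).1 r₂ ha0 hab ha hb hf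
    refine (hlim.sub_const (1 / (k : ℂ) * Z r₁)).congr fun N => ?_
    have hfi : IntervalIntegrable f volume a b :=
      hf.continuousOn.intervalIntegrable_of_Icc hab.le
    rw [Finset.sum_erase_eq_sub (by simp), Finset.sum_comm]
    congr 1
    · refine Finset.sum_congr rfl fun n _ => ?_
      rw [← Finset.mul_sum, ← intervalIntegral.integral_finsetSum]
      · simp only [Finset.mul_sum, Int.cast_natCast]
        rfl
      · intro m _
        refine hfi.mul_continuousOn (Continuous.continuousOn ?_)
        exact continuous_const.mul (continuous_ee.comp (by fun_prop))
    · have h0 : ee 0 = 1 := by simpa using ee_intCast 0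
      simp only [Int.cast_zero, neg_zero, zero_mul, zero_div, h0, mul_one, one_mul,
        intervalIntegral.integral_mul_const, hZ]
      rw [mul_left_comm, Finset.mul_sum]
      simp only [one_div_mul_one_div, hS]
  · have hfa : 0 ≤ ⌊a⌋ := Int.floor_nonneg.mpr ha0
    have hmain : ∑ n ∈ Finset.Ioc ⌊a⌋ ⌊b⌋, χ n * (n.toNat.divisors.card : ℂ) * f (n : ℝ)
        = ∑ r₁ ∈ Finset.Icc (1 : ℤ) k, ∑ r₂ ∈ Finset.Icc (1 : ℤ) k, χ (r₁ * r₂) * T r₁ r₂ := by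
      have h1 := sum_card_divisors_mul (B := ⌊b⌋) hfa fun n => χ n * f (n : ℝ)
      refine Eq.trans (Finset.sum_congr rfl fun n _ => by ring)
        (h1.trans ((sum_sum_filter_emod hkZ _ _).symm.trans ?_))
      refine Finset.sum_congr rfl fun r₁ _ => ?_
      simp only [hT, Finset.mul_sum]
      refine Eq.trans ?_ Finset.sum_comm
      refine Finset.sum_congr rfl fun m hm => (sum_sum_filter_emod hkZ _ _).symm.trans ?_
      refine Finset.sum_congr rfl fun r₂ _ => Finset.sum_congr rfl fun l hl => ?_
      have h2 : m ≡ r₁ [ZMOD k] := (Finset.mem_filter.mp hm).2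
      have h3 : l ≡ r₂ [ZMOD k] := (Finset.mem_filter.mp hl).2
      rw [hper _ _ (h2.mul h3), mul_ite, mul_zero]
    rw [hmain, Finset.mul_sum, ← Finset.sum_add_distrib]
    refine Finset.sum_congr rfl fun r₁ _ => ?_
    rw [Finset.mul_sum, ← Finset.sum_add_distrib]
    exact Finset.sum_congr rfl fun r₂ _ => by ring
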